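/- A binary sextic over an algebraically closed field k of characteristic ≠ 2,3,5 has a root of multiplicity exactly three if and only if its basic invariants satisfy I_2 = 3r^2, I_4 = 81r^4, I_6 = r^6, I_10 = 0 for some nonzero r ∈ k. -/

import Mathlib

open MvPolynomial
noncomputable section

/-- The binary form of degree `d` with coefficient vector `a`. -/
def toForm (k : Type*) [CommSemiring k] (d : ℕ) (a : Fin (d+1) → k) :
    MvPolynomial (Fin 2) k :=
  ∑ i : Fin (d+1), C (a i) * X 0 ^ (d - (i : ℕ)) * X 1 ^ (i : ℕ)

/-- Coordinate change by the matrix `g` : `X ↦ g00 X + g01 Y`, `Y ↦ g10 X + g11 Y`. -/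
def matAct (k : Type*) [CommSemiring k] (g : Matrix (Fin 2) (Fin 2) k)
    (p : MvPolynomial (Fin 2) k) : MvPolynomial (Fin 2) k :=
  aeval (fun j : Fin 2 => C (g j 0) * X 0 + C (g j 1) * X 1) p

/-- The coefficient of `X^(d-i) Y^i` in a binary form of degree `d`. -/
def formCoeff (k : Type*) [CommSemiring k] (d : ℕ) (p : MvPolynomial (Fin 2) k)
    (i : Fin (d+1)) : k :=
  coeff (Finsupp.single 0 (d - (i : ℕ)) + Finsupp.single 1 (i : ℕ)) p

/-- The induced action of a `2×2` matrix on the coefficient vector of a binary form. -/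
def actCoeff (k : Type*) [CommSemiring k] (d : ℕ) (g : Matrix (Fin 2) (Fin 2) k)
    (a : Fin (d+1) → k) : Fin (d+1) → k :=
  formCoeff k d (matAct k g (toForm k d a))

/-- `P ∈ k[A_0,…,A_d]` is an `SL₂(k)`-invariant. -/
def SL2Invariant (k : Type*) [CommRing k] (d : ℕ)
    (P : MvPolynomial (Fin (d+1)) k) : Prop :=
  ∀ g : Matrix.SpecialLinearGroup (Fin 2) k, ∀ a : Fin (d+1) → k,
    eval (actCoeff k d (g : Matrix (Fin 2) (Fin 2) k) a) P = eval a P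

/-- The ring `R_d` of `SL₂(k)`-invariants in `k[A_0,…,A_d]`. -/
def Rd (k : Type*) [Field k] (d : ℕ) : Subalgebra k (MvPolynomial (Fin (d+1)) k) where
  carrier := {P | SL2Invariant k d P}
  mul_mem' := fun hP hQ g a => by simp only [map_mul]; rw [hP g a, hQ g a]
  add_mem' := fun hP hQ g a => by simp only [map_add]; rw [hP g a, hQ g a]
  algebraMap_mem' := fun r g a => by simp [SL2Invariant]
open scoped Classical

/-- `D_{ij} = x_i y_j - x_j y_i` for the roots `(x_i , y_i)` of a binary sextic. -/
def Dij {k : Type*} [CommRing k] (x y : Fin 6 → k) (i j : Fin 6) : k :=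
  x i * y j - x j * y i

/-- `Σ D_{ij}² D_{kl}² D_{mn}²`, the sum running over the 15 partitions of `{1,…,6}`
into three pairs (each partition counted 48 times by permutations). -/
def sumPairs {k : Type*} [Field k] (x y : Fin 6 → k) : k :=
  (48 : k)⁻¹ * ∑ σ : Equiv.Perm (Fin 6),
    (Dij x y (σ 0) (σ 1))^2 * (Dij x y (σ 2) (σ 3))^2 * (Dij x y (σ 4) (σ 5))^2

/-- `Σ D_{ij}² D_{jk}² D_{ki}² D_{lm}² D_{mn}² D_{nl}²`, the sum running over the
10 partitions of `{1,…,6}` into two 3-sets (each counted 72 times by permutations). -/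
def sumB {k : Type*} [Field k] (x y : Fin 6 → k) : k :=
  (72 : k)⁻¹ * ∑ σ : Equiv.Perm (Fin 6),
    ((Dij x y (σ 0) (σ 1))^2 * (Dij x y (σ 1) (σ 2))^2 * (Dij x y (σ 2) (σ 0))^2)
    * ((Dij x y (σ 3) (σ 4))^2 * (Dij x y (σ 4) (σ 5))^2 * (Dij x y (σ 5) (σ 3))^2)

/-- The 60-term sum over pairs of matched triangles (each matched configuration
counted 12 times by permutations). -/
def sumC {k : Type*} [Field k] (x y : Fin 6 → k) : k :=
  (12 : k)⁻¹ * ∑ σ : Equiv.Perm (Fin 6),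
    ((Dij x y (σ 0) (σ 1))^2 * (Dij x y (σ 1) (σ 2))^2 * (Dij x y (σ 2) (σ 0))^2)
    * ((Dij x y (σ 3) (σ 4))^2 * (Dij x y (σ 4) (σ 5))^2 * (Dij x y (σ 5) (σ 3))^2)
    * ((Dij x y (σ 0) (σ 3))^2 * (Dij x y (σ 1) (σ 4))^2 * (Dij x y (σ 2) (σ 5))^2)

/-- The basic invariant `I₂` of a binary sextic, expressed through the roots, in the
normalization used by the paper's coefficient formulas. -/
def I2r {k : Type*} [Field k] (x y : Fin 6 → k) : k :=
  -(2 : k)⁻¹ * sumPairs x y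

/-- The basic invariant `I₄` (`= 4I₂² - B` in the paper's normalization of `B`),
expressed through the roots. -/
def I4r {k : Type*} [Field k] (x y : Fin 6 → k) : k :=
  9 * (I2r x y)^2 - 80 * sumB x y

/-- The basic invariant `I₆` (`= 8I₂³ - 160 I₂ I₄ - C` in the paper's normalization
of `C`), expressed through the roots. -/
def I6r {k : Type*} [Field k] (x y : Fin 6 → k) : k :=
  (13/108 : k) * (I2r x y)^3 - (1/108 : k) * I2r x y * I4r x y + (25/9 : k) * sumC x y

/-- The discriminant `I₁₀ = ∏_{i<j} D_{ij}²`. -/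
def I10r {k : Type*} [Field k] (x y : Fin 6 → k) : k :=
  ∏ p ∈ Finset.univ.filter (fun p : Fin 6 × Fin 6 => p.1 < p.2), (Dij x y p.1 p.2)^2

/-- The coefficient of `X^(6-j) Y^j` in the sextic `∏ (y_i X - x_i Y)`. -/
def sexticCoeff {k : Type*} [Field k] (x y : Fin 6 → k) (j : Fin 7) : k :=
  formCoeff k 6 (∏ i : Fin 6,
    (MvPolynomial.C (y i) * MvPolynomial.X 0 - MvPolynomial.C (x i) * MvPolynomial.X 1)) j

/-- The multiplicity of the `i`-th root among the six roots of the sextic. -/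
def rootMult {k : Type*} [Field k] (x y : Fin 6 → k) (i : Fin 6) : ℕ :=
  (Finset.univ.filter (fun j => x i * y j = x j * y i)).card

namespace TripleRootProof

open Equiv

theorem perm_sum_succ {k : Type*} [AddCommMonoid k] (n : ℕ) (F : (Fin (n+1) → Fin (n+1)) → k) :
    ∑ σ : Perm (Fin (n+1)), F σ =
      ∑ p : Fin (n+1), ∑ τ : Perm (Fin n),
        F (Fin.cons p (fun i => swap 0 p (τ i).succ)) := by
  rw [← Equiv.sum_comp Perm.decomposeFin.symm, Fintype.sum_prod_type]
  refine Finset.sum_congr rfl fun p _ => Finset.sum_congr rfl fun τ _ => ?_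
  congr 1
  funext i
  refine Fin.cases ?_ (fun i => ?_) i
  · simp
  · simp

theorem perm_sum_six {k : Type*} [AddCommMonoid k]
    (G : Fin 6 → Fin 6 → Fin 6 → Fin 6 → Fin 6 → Fin 6 → k) :
    ∑ σ : Perm (Fin 6), G (σ 0) (σ 1) (σ 2) (σ 3) (σ 4) (σ 5) =
      ∑ a : Fin 6, ∑ b : Fin 5, ∑ c : Fin 4, ∑ d : Fin 3, ∑ e : Fin 2,
        G a (swap 0 a b.succ) (swap 0 a (swap 0 b c.succ).succ)
          (swap 0 a (swap 0 b (swap 0 c d.succ).succ).succ)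
          (swap 0 a (swap 0 b (swap 0 c (swap 0 d e.succ).succ).succ).succ)
          (swap 0 a (swap 0 b (swap 0 c (swap 0 d (swap 0 e 1).succ).succ).succ).succ) := by
  rw [perm_sum_succ 5 (fun σ => G (σ 0) (σ 1) (σ 2) (σ 3) (σ 4) (σ 5))]
  refine Finset.sum_congr rfl fun a _ => ?_
  refine (perm_sum_succ 4 (fun σ => G a (swap 0 a (σ 0).succ) (swap 0 a (σ 1).succ)
    (swap 0 a (σ 2).succ) (swap 0 a (σ 3).succ) (swap 0 a (σ 4).succ))).trans ?_
  refine Finset.sum_congr rfl fun b _ => ?_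
  refine (perm_sum_succ 3 (fun σ => G a (swap 0 a b.succ) (swap 0 a (swap 0 b (σ 0).succ).succ)
    (swap 0 a (swap 0 b (σ 1).succ).succ)
    (swap 0 a (swap 0 b (σ 2).succ).succ) (swap 0 a (swap 0 b (σ 3).succ).succ))).trans ?_
  refine Finset.sum_congr rfl fun c _ => ?_
  refine (perm_sum_succ 2 (fun σ => G a (swap 0 a b.succ) (swap 0 a (swap 0 b c.succ).succ)
    (swap 0 a (swap 0 b (swap 0 c (σ 0).succ).succ).succ)
    (swap 0 a (swap 0 b (swap 0 c (σ 1).succ).succ).succ)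
    (swap 0 a (swap 0 b (swap 0 c (σ 2).succ).succ).succ))).trans ?_
  refine Finset.sum_congr rfl fun d _ => ?_
  refine (perm_sum_succ 1 (fun σ => G a (swap 0 a b.succ) (swap 0 a (swap 0 b c.succ).succ)
    (swap 0 a (swap 0 b (swap 0 c d.succ).succ).succ)
    (swap 0 a (swap 0 b (swap 0 c (swap 0 d (σ 0).succ).succ).succ).succ)
    (swap 0 a (swap 0 b (swap 0 c (swap 0 d (σ 1).succ).succ).succ).succ))).trans ?_
  refine Finset.sum_congr rfl fun e _ => ?_
  rw [Fintype.sum_eq_single 1 (fun τ h => (h (Subsingleton.elim _ _)).elim)]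
  rfl


set_option maxHeartbeats 4000000 in
theorem expand_pairs {k : Type*} [Field k] (e : Fin 6 → Fin 6 → k) (he : ∀ i j, e j i = e i j) :
    ∑ σ : Perm (Fin 6), e (σ 0) (σ 1) * e (σ 2) (σ 3) * e (σ 4) (σ 5) =
    48 * (e 0 1 * e 2 3 * e 4 5 + e 0 1 * e 2 4 * e 3 5 + e 0 1 * e 2 5 * e 3 4 +
      e 0 2 * e 1 3 * e 4 5 + e 0 2 * e 1 4 * e 3 5 + e 0 2 * e 1 5 * e 3 4 +
      e 0 3 * e 1 2 * e 4 5 + e 0 3 * e 1 4 * e 2 5 + e 0 3 * e 1 5 * e 2 4 +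
      e 0 4 * e 1 2 * e 3 5 + e 0 4 * e 1 3 * e 2 5 + e 0 4 * e 1 5 * e 2 3 +
      e 0 5 * e 1 2 * e 3 4 + e 0 5 * e 1 3 * e 2 4 + e 0 5 * e 1 4 * e 2 3) := by
  rw [perm_sum_six (fun a b c d f g => e a b * e c d * e f g)]
  simp only [Fin.sum_univ_succ, Fin.sum_univ_zero]
  simp [swap_apply_def, Fin.ext_iff]
  simp only [he 0 1, he 0 2, he 0 3, he 0 4, he 0 5, he 1 2, he 1 3, he 1 4, he 1 5, he 2 3,
    he 2 4, he 2 5, he 3 4, he 3 5, he 4 5]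
  ring

set_option maxHeartbeats 4000000 in
theorem expand_B {k : Type*} [Field k] (e : Fin 6 → Fin 6 → k) (he : ∀ i j, e j i = e i j)
    (h01 : e 0 1 = 0) :
    ∑ σ : Perm (Fin 6), (e (σ 0) (σ 1) * e (σ 1) (σ 2) * e (σ 2) (σ 0)) *
      (e (σ 3) (σ 4) * e (σ 4) (σ 5) * e (σ 5) (σ 3)) =
    72 * (e 0 2 * e 0 3 * e 1 4 * e 1 5 * e 2 3 * e 4 5 +
      e 0 2 * e 0 4 * e 1 3 * e 1 5 * e 2 4 * e 3 5 +
      e 0 2 * e 0 5 * e 1 3 * e 1 4 * e 2 5 * e 3 4 +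
      e 0 3 * e 0 4 * e 1 2 * e 1 5 * e 2 5 * e 3 4 +
      e 0 3 * e 0 5 * e 1 2 * e 1 4 * e 2 4 * e 3 5 +
      e 0 4 * e 0 5 * e 1 2 * e 1 3 * e 2 3 * e 4 5) := by
  rw [perm_sum_six (fun a b c d f g => (e a b * e b c * e c a) * (e d f * e f g * e g d))]
  simp only [Fin.sum_univ_succ, Fin.sum_univ_zero]
  simp [swap_apply_def, Fin.ext_iff]
  simp only [he 0 1, he 0 2, he 0 3, he 0 4, he 0 5, he 1 2, he 1 3, he 1 4, he 1 5, he 2 3,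
    he 2 4, he 2 5, he 3 4, he 3 5, he 4 5, h01, mul_zero, zero_mul, add_zero, zero_add]
  ring

set_option maxHeartbeats 4000000 in
theorem expand_C_zero {k : Type*} [Field k] (e : Fin 6 → Fin 6 → k) (he : ∀ i j, e j i = e i j)
    (h01 : e 0 1 = 0) (h02 : e 0 2 = 0) (h12 : e 1 2 = 0) :
    ∑ σ : Perm (Fin 6), (e (σ 0) (σ 1) * e (σ 1) (σ 2) * e (σ 2) (σ 0)) *
      (e (σ 3) (σ 4) * e (σ 4) (σ 5) * e (σ 5) (σ 3)) *
      (e (σ 0) (σ 3) * e (σ 1) (σ 4) * e (σ 2) (σ 5)) = 0 := by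
  rw [perm_sum_six (fun a b c d f g => (e a b * e b c * e c a) * (e d f * e f g * e g d) *
    (e a d * e b f * e c g))]
  simp only [Fin.sum_univ_succ, Fin.sum_univ_zero]
  simp [swap_apply_def, Fin.ext_iff, he 0 1, he 0 2, he 1 2, h01, h02, h12]

set_option maxHeartbeats 4000000 in
theorem expand_C {k : Type*} [Field k] (e : Fin 6 → Fin 6 → k) (he : ∀ i j, e j i = e i j)
    (L p q r s a b c d f g : k)
    (h01 : e 0 1 = 0) (h02 : e 0 2 = p) (h03 : e 0 3 = q) (h04 : e 0 4 = r) (h05 : e 0 5 = s)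
    (h12 : e 1 2 = L * p) (h13 : e 1 3 = L * q) (h14 : e 1 4 = L * r) (h15 : e 1 5 = L * s)
    (h23 : e 2 3 = p * q * a) (h24 : e 2 4 = p * r * b) (h25 : e 2 5 = p * s * c)
    (h34 : e 3 4 = q * r * d) (h35 : e 3 5 = q * s * f) (h45 : e 4 5 = r * s * g) :
    ∑ σ : Perm (Fin 6), (e (σ 0) (σ 1) * e (σ 1) (σ 2) * e (σ 2) (σ 0)) *
      (e (σ 3) (σ 4) * e (σ 4) (σ 5) * e (σ 5) (σ 3)) *
      (e (σ 0) (σ 3) * e (σ 1) (σ 4) * e (σ 2) (σ 5)) =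
    24 * (L * p * q * r * s) ^ 3 * (a * d * g + a * f * g + b * d * f + b * f * g + c * f * d +
      c * g * d + d * a * c + d * b * c + f * a * b + f * c * b + g * b * a + g * c * a) := by
  rw [perm_sum_six (fun a b c d f g => (e a b * e b c * e c a) * (e d f * e f g * e g d) *
    (e a d * e b f * e c g))]
  simp only [Fin.sum_univ_succ, Fin.sum_univ_zero]
  simp [swap_apply_def, Fin.ext_iff]
  simp only [he 0 1, he 0 2, he 0 3, he 0 4, he 0 5, he 1 2, he 1 3, he 1 4, he 1 5, he 2 3,
    he 2 4, he 2 5, he 3 4, he 3 5, he 4 5, h01, mul_zero, zero_mul, add_zero, zero_add]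
  simp only [h02, h03, h04, h05, h12, h13, h14, h15, h23, h24, h25, h34, h35, h45]
  ring

theorem Dij_sq_symm {k : Type*} [Field k] (x y : Fin 6 → k) (i j : Fin 6) :
    (Dij x y j i) ^ 2 = (Dij x y i j) ^ 2 := by
  unfold Dij; ring

theorem sumPairs_comp {k : Type*} [Field k] (x y : Fin 6 → k) (τ : Perm (Fin 6)) :
    sumPairs (x ∘ τ) (y ∘ τ) = sumPairs x y := by
  unfold sumPairs
  conv_rhs => rw [← Equiv.sum_comp (Equiv.mulLeft τ)]
  rfl

theorem sumB_comp {k : Type*} [Field k] (x y : Fin 6 → k) (τ : Perm (Fin 6)) :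
    sumB (x ∘ τ) (y ∘ τ) = sumB x y := by
  unfold sumB
  conv_rhs => rw [← Equiv.sum_comp (Equiv.mulLeft τ)]
  rfl

theorem sumC_comp {k : Type*} [Field k] (x y : Fin 6 → k) (τ : Perm (Fin 6)) :
    sumC (x ∘ τ) (y ∘ τ) = sumC x y := by
  unfold sumC
  conv_rhs => rw [← Equiv.sum_comp (Equiv.mulLeft τ)]
  rfl

/-- A permutation carrying `{i < n}` onto a given set with `n` elements. -/
theorem exists_perm_of_card (s : Finset (Fin 6)) (n : ℕ) (hn : n ≤ 6) (hs : s.card = n) :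
    ∃ τ : Perm (Fin 6), ∀ i : Fin 6, (i : ℕ) < n ↔ τ i ∈ s := by
  have hc : Fintype.card {i : Fin 6 // (i : ℕ) < n} = Fintype.card {i : Fin 6 // i ∈ s} := by
    rw [Fintype.card_coe, hs, Fintype.card_subtype]
    interval_cases n <;> decide
  let f := Fintype.equivOfCardEq hc
  refine ⟨f.extendSubtype, fun i => ⟨fun h => f.extendSubtype_mem i h, fun h => ?_⟩⟩
  by_contra h'
  exact f.extendSubtype_not_mem i h' h

/-- Proportional nonzero vectors. -/
theorem exists_scalar {k : Type*} [Field k] {a b c d : k} (h : (a, b) ≠ (0, 0))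
    (hD : a * d = c * b) : ∃ l : k, c = l * a ∧ d = l * b := by
  by_cases ha : a = 0
  · have hb : b ≠ 0 := by
      intro hb; exact h (by rw [ha, hb])
    refine ⟨d / b, ?_, by field_simp⟩
    rw [ha, zero_mul] at hD
    rw [ha, mul_zero]
    exact (mul_eq_zero.mp hD.symm).resolve_right hb
  · refine ⟨c / a, by field_simp, ?_⟩
    field_simp
    linear_combination hD

theorem prop_trans {k : Type*} [Field k] {x y : Fin 6 → k} (hroots : ∀ i, (x i, y i) ≠ (0, 0))
    {i a b : Fin 6} (ha : x i * y a = x a * y i) (hb : x i * y b = x b * y i) :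
    x a * y b = x b * y a := by
  obtain ⟨l, h1, h2⟩ := exists_scalar (hroots i) ha
  obtain ⟨m, h3, h4⟩ := exists_scalar (hroots i) hb
  rw [h1, h2, h3, h4]; ring

theorem sumPairs_expand {k : Type*} [Field k] (h2 : (2 : k) ≠ 0) (h3 : (3 : k) ≠ 0)
    (x y : Fin 6 → k) (e : Fin 6 → Fin 6 → k) (hE : ∀ i j, e i j = (Dij x y i j) ^ 2) :
    sumPairs x y =
     (e 0 1 * e 2 3 * e 4 5 + e 0 1 * e 2 4 * e 3 5 + e 0 1 * e 2 5 * e 3 4 +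
      e 0 2 * e 1 3 * e 4 5 + e 0 2 * e 1 4 * e 3 5 + e 0 2 * e 1 5 * e 3 4 +
      e 0 3 * e 1 2 * e 4 5 + e 0 3 * e 1 4 * e 2 5 + e 0 3 * e 1 5 * e 2 4 +
      e 0 4 * e 1 2 * e 3 5 + e 0 4 * e 1 3 * e 2 5 + e 0 4 * e 1 5 * e 2 3 +
      e 0 5 * e 1 2 * e 3 4 + e 0 5 * e 1 3 * e 2 4 + e 0 5 * e 1 4 * e 2 3) := by
  have h48 : (48 : k) ≠ 0 := by
    have : (48 : k) = 2 ^ 4 * 3 := by norm_num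
    rw [this]; exact mul_ne_zero (pow_ne_zero _ h2) h3
  unfold sumPairs
  simp only [← hE]
  rw [expand_pairs e (fun i j => by rw [hE, hE, Dij_sq_symm]), inv_mul_cancel_left₀ h48]

/-- A root of multiplicity at least four kills `I₂`. -/
theorem sumPairs_eq_zero {k : Type*} [Field k] (h2 : (2 : k) ≠ 0) (h3 : (3 : k) ≠ 0)
    (x y : Fin 6 → k) (hroots : ∀ i, (x i, y i) ≠ (0, 0)) (i : Fin 6)
    (hi : 4 ≤ rootMult x y i) : sumPairs x y = 0 := by
  obtain ⟨s, hs, hc⟩ := Finset.exists_subset_card_eq hi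
  obtain ⟨τ, hτ⟩ := exists_perm_of_card s 4 (by norm_num) hc
  have key : ∀ a b : Fin 6, (a : ℕ) < 4 → (b : ℕ) < 4 → (Dij (x ∘ τ) (y ∘ τ) a b) ^ 2 = 0 := by
    intro a b ha hb
    have h1 := hs ((hτ a).1 ha)
    have h2 := hs ((hτ b).1 hb)
    simp only [Finset.mem_filter, Finset.mem_univ, true_and] at h1 h2
    have := prop_trans hroots h1 h2
    simp only [Dij, Function.comp]
    rw [this]; ring
  rw [← sumPairs_comp x y τ,
    sumPairs_expand h2 h3 _ _ (fun a b => (Dij (x ∘ τ) (y ∘ τ) a b) ^ 2) (fun _ _ => rfl)]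
  have k01 := key 0 1 (by decide) (by decide)
  have k02 := key 0 2 (by decide) (by decide)
  have k03 := key 0 3 (by decide) (by decide)
  have k12 := key 1 2 (by decide) (by decide)
  have k13 := key 1 3 (by decide) (by decide)
  have k23 := key 2 3 (by decide) (by decide)
  simp only [k01, k02, k03, k12, k13, k23, mul_zero, zero_mul, add_zero]

theorem I10r_eq_zero_iff {k : Type*} [Field k] (x y : Fin 6 → k) :
    I10r x y = 0 ↔ ∃ a b : Fin 6, a < b ∧ Dij x y a b = 0 := by
  unfold I10r
  rw [Finset.prod_eq_zero_iff]
  constructor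
  · rintro ⟨⟨a, b⟩, hp, h⟩
    simp only [Finset.mem_filter, Finset.mem_univ, true_and] at hp
    exact ⟨a, b, hp, pow_eq_zero_iff (two_ne_zero) |>.1 h⟩
  · rintro ⟨a, b, hab, h⟩
    exact ⟨(a, b), by simpa using hab, by simp [h]⟩

/-- The forward direction for roots `0,1,2` coinciding. -/
theorem triple_forward {k : Type*} [Field k] [IsAlgClosed k]
    (h2 : (2 : k) ≠ 0) (h3 : (3 : k) ≠ 0)
    (x y : Fin 6 → k) (hroots : ∀ i, (x i, y i) ≠ (0, 0))
    (h01 : x 0 * y 1 = x 1 * y 0) (h02 : x 0 * y 2 = x 2 * y 0)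
    (n3 : x 0 * y 3 ≠ x 3 * y 0) (n4 : x 0 * y 4 ≠ x 4 * y 0) (n5 : x 0 * y 5 ≠ x 5 * y 0) :
    sumB x y = 0 ∧ sumC x y = 0 ∧ ∃ r : k, r ≠ 0 ∧ sumPairs x y = - 6 * r ^ 2 := by
  obtain ⟨l, hl1, hl2⟩ := exists_scalar (hroots 0) h01
  obtain ⟨m, hm1, hm2⟩ := exists_scalar (hroots 0) h02
  have hl : l ≠ 0 := by
    rintro rfl
    exact hroots 1 (by rw [hl1, hl2, zero_mul, zero_mul])
  have hm : m ≠ 0 := by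
    rintro rfl
    exact hroots 2 (by rw [hm1, hm2, zero_mul, zero_mul])
  have e01 : (Dij x y 0 1) ^ 2 = 0 := by unfold Dij; rw [h01]; ring
  have e02 : (Dij x y 0 2) ^ 2 = 0 := by unfold Dij; rw [h02]; ring
  have e12 : (Dij x y 1 2) ^ 2 = 0 := by unfold Dij; rw [hl1, hl2, hm1, hm2]; ring
  refine ⟨?_, ?_, ?_⟩
  · unfold sumB
    rw [expand_B (fun i j => (Dij x y i j) ^ 2) (fun i j => Dij_sq_symm x y i j) e01]
    simp only [e02, e12]
    ring
  · unfold sumC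
    rw [expand_C_zero (fun i j => (Dij x y i j) ^ 2) (fun i j => Dij_sq_symm x y i j) e01 e02 e12,
      mul_zero]
  · obtain ⟨i, hi⟩ := IsAlgClosed.exists_pow_nat_eq (-1 : k) (n := 2) (by norm_num)
    have hi0 : i ≠ 0 := by
      rintro rfl
      norm_num at hi
    refine ⟨i * l * m * Dij x y 0 3 * Dij x y 0 4 * Dij x y 0 5, ?_, ?_⟩
    · have d3 : Dij x y 0 3 ≠ 0 := sub_ne_zero.2 n3
      have d4 : Dij x y 0 4 ≠ 0 := sub_ne_zero.2 n4
      have d5 : Dij x y 0 5 ≠ 0 := sub_ne_zero.2 n5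
      exact mul_ne_zero (mul_ne_zero (mul_ne_zero (mul_ne_zero (mul_ne_zero hi0 hl) hm) d3) d4) d5
    · rw [sumPairs_expand h2 h3 x y (fun a b => (Dij x y a b) ^ 2) (fun _ _ => rfl)]
      have e1 : ∀ j, Dij x y 1 j = l * Dij x y 0 j := by
        intro j; unfold Dij; rw [hl1, hl2]; ring
      have e2 : ∀ j, Dij x y 2 j = m * Dij x y 0 j := by
        intro j; unfold Dij; rw [hm1, hm2]; ring
      simp only [e01, e02, e12]
      rw [e1 3, e1 4, e1 5, e2 3, e2 4, e2 5]
      linear_combination (-6 * (l * m * Dij x y 0 3 * Dij x y 0 4 * Dij x y 0 5) ^ 2 * (-1)) * hi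

/-- The quartic argument: vanishing of the two semi-invariants forces a triple root. -/
theorem quartic_triple {k : Type*} [Field k] (h2 : (2 : k) ≠ 0) (h3 : (3 : k) ≠ 0)
    (a b c d : k)
    (hB : ((a - b) * (c - d)) ^ 2 + ((a - c) * (b - d)) ^ 2 + ((a - d) * (b - c)) ^ 2 = 0)
    (hJ : ((a - b) * (c - d) - (a - c) * (d - b)) * ((a - c) * (d - b) - (a - d) * (b - c)) *
      ((a - d) * (b - c) - (a - b) * (c - d)) = 0) :
    (a = b ∧ a = c) ∨ (a = b ∧ a = d) ∨ (a = c ∧ a = d) ∨ (b = c ∧ b = d) := by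
  have key : ∀ u v w : k, u + v + w = 0 → u ^ 2 + v ^ 2 + w ^ 2 = 0 → u = v →
      u = 0 ∧ v = 0 ∧ w = 0 := by
    intro u v w hs hq huv
    subst huv
    have hw : w = -2 * u := by linear_combination hs
    have h6 : (2 * 3) * u ^ 2 = 0 := by rw [hw] at hq; linear_combination hq
    have hu : u = 0 :=
      pow_eq_zero_iff (two_ne_zero) |>.1 ((mul_eq_zero.1 h6).resolve_left (mul_ne_zero h2 h3))
    exact ⟨hu, hu, by rw [hw, hu, mul_zero]⟩
  have hs : (a - b) * (c - d) + (a - c) * (d - b) + (a - d) * (b - c) = 0 := by ring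
  have all0 : (a - b) * (c - d) = 0 ∧ (a - c) * (d - b) = 0 ∧ (a - d) * (b - c) = 0 := by
    generalize hu : (a - b) * (c - d) = u at *
    generalize hw : (a - d) * (b - c) = w at *
    have hB' : u ^ 2 + ((a - c) * (d - b)) ^ 2 + w ^ 2 = 0 := by linear_combination hB
    generalize hv : (a - c) * (d - b) = v at *
    rcases mul_eq_zero.1 hJ with h | h
    · rcases mul_eq_zero.1 h with h | h
      · exact key u v w hs hB' (sub_eq_zero.1 h)
      · obtain ⟨p, q, r⟩ := key v w u (by linear_combination hs) (by linear_combination hB')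
          (sub_eq_zero.1 h)
        exact ⟨r, p, q⟩
    · obtain ⟨p, q, r⟩ := key w u v (by linear_combination hs) (by linear_combination hB')
        (sub_eq_zero.1 h)
      exact ⟨q, r, p⟩
  obtain ⟨hu, hv, hw⟩ := all0
  simp only [mul_eq_zero, sub_eq_zero] at hu hv hw
  grind

/-- The main step of the converse, with roots `0` and `1` coinciding. -/
theorem triple_backward {k : Type*} [Field k]
    (h2 : (2 : k) ≠ 0) (h3 : (3 : k) ≠ 0)
    (x y : Fin 6 → k) (hroots : ∀ i, (x i, y i) ≠ (0, 0))
    (h01 : x 0 * y 1 = x 1 * y 0) (hB : sumB x y = 0) (hC : sumC x y = 0) :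
    ∃ i a b : Fin 6, i ≠ a ∧ i ≠ b ∧ a ≠ b ∧ Dij x y i a = 0 ∧ Dij x y i b = 0 := by
  have D01 : Dij x y 0 1 = 0 := sub_eq_zero.2 h01
  by_cases d2 : Dij x y 0 2 = 0
  · exact ⟨0, 1, 2, by decide, by decide, by decide, D01, d2⟩
  by_cases d3 : Dij x y 0 3 = 0
  · exact ⟨0, 1, 3, by decide, by decide, by decide, D01, d3⟩
  by_cases d4 : Dij x y 0 4 = 0
  · exact ⟨0, 1, 4, by decide, by decide, by decide, D01, d4⟩
  by_cases d5 : Dij x y 0 5 = 0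
  · exact ⟨0, 1, 5, by decide, by decide, by decide, D01, d5⟩
  obtain ⟨l, hl1, hl2⟩ := exists_scalar (hroots 0) h01
  have hl : l ≠ 0 := by
    rintro rfl
    exact hroots 1 (by rw [hl1, hl2, zero_mul, zero_mul])
  obtain ⟨p, q, hpq⟩ : ∃ p q : k, x 0 * q - p * y 0 = 1 := by
    by_cases hx : x 0 = 0
    · have hy : y 0 ≠ 0 := by
        intro hy; exact hroots 0 (by rw [hx, hy])
      exact ⟨-(y 0)⁻¹, 0, by field_simp; ring⟩
    · exact ⟨0, (x 0)⁻¹, by field_simp; ring⟩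
  obtain ⟨t, ht⟩ : ∃ t : Fin 6 → k, ∀ j, t j = (p * y j - x j * q) / Dij x y 0 j := ⟨_, fun _ => rfl⟩
  have hD : ∀ i j, Dij x y 0 i ≠ 0 → Dij x y 0 j ≠ 0 →
      Dij x y i j = Dij x y 0 i * Dij x y 0 j * (t j - t i) := by
    intro i j hi hj
    rw [ht, ht]
    field_simp
    unfold Dij
    linear_combination (-(x i * y j - x j * y i)) * hpq
  have e1 : ∀ j, Dij x y 1 j = l * Dij x y 0 j := by
    intro j; unfold Dij; rw [hl1, hl2]; ring
  have e01 : (Dij x y 0 1) ^ 2 = 0 := by rw [D01]; ring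
  have hsq : ∀ i j, Dij x y 0 i ≠ 0 → Dij x y 0 j ≠ 0 →
      (Dij x y i j) ^ 2 = (Dij x y 0 i) ^ 2 * (Dij x y 0 j) ^ 2 * (t i - t j) ^ 2 := by
    intro i j hi hj
    rw [hD i j hi hj]; ring
  have e1' : ∀ j, (Dij x y 1 j) ^ 2 = l ^ 2 * (Dij x y 0 j) ^ 2 := by
    intro j; rw [e1]; ring
  have h72 : (72 : k)⁻¹ ≠ 0 := by
    have : (72 : k) = 2 ^ 3 * 3 ^ 2 := by norm_num
    rw [this]; exact inv_ne_zero (mul_ne_zero (pow_ne_zero _ h2) (pow_ne_zero _ h3))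
  have h12 : (12 : k)⁻¹ ≠ 0 := by
    have : (12 : k) = 2 ^ 2 * 3 := by norm_num
    rw [this]; exact inv_ne_zero (mul_ne_zero (pow_ne_zero _ h2) h3)
  have hP : l ^ 2 * (Dij x y 0 2) ^ 2 * (Dij x y 0 3) ^ 2 * (Dij x y 0 4) ^ 2 *
      (Dij x y 0 5) ^ 2 ≠ 0 := by
    refine mul_ne_zero (mul_ne_zero (mul_ne_zero (mul_ne_zero ?_ ?_) ?_) ?_) ?_ <;>
      exact pow_ne_zero _ (by assumption)
  unfold sumB at hB
  rw [expand_B (fun i j => (Dij x y i j) ^ 2) (fun i j => Dij_sq_symm x y i j) e01] at hB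
  unfold sumC at hC
  rw [expand_C (fun i j => (Dij x y i j) ^ 2) (fun i j => Dij_sq_symm x y i j) (l ^ 2)
    ((Dij x y 0 2) ^ 2) ((Dij x y 0 3) ^ 2) ((Dij x y 0 4) ^ 2) ((Dij x y 0 5) ^ 2)
    ((t 2 - t 3) ^ 2) ((t 2 - t 4) ^ 2) ((t 2 - t 5) ^ 2) ((t 3 - t 4) ^ 2) ((t 3 - t 5) ^ 2)
    ((t 4 - t 5) ^ 2) e01 rfl rfl rfl rfl (e1' 2) (e1' 3) (e1' 4) (e1' 5)
    (hsq 2 3 d2 d3) (hsq 2 4 d2 d4) (hsq 2 5 d2 d5) (hsq 3 4 d3 d4) (hsq 3 5 d3 d5)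
    (hsq 4 5 d4 d5)] at hC
  simp only [e1', hsq 2 3 d2 d3, hsq 2 4 d2 d4, hsq 2 5 d2 d5, hsq 3 4 d3 d4, hsq 3 5 d3 d5,
    hsq 4 5 d4 d5] at hB
  have hB1 := (mul_eq_zero.1 hB).resolve_left h72
  have hC1 := (mul_eq_zero.1 hC).resolve_left h12
  clear hB hC
  generalize Dij x y 0 2 ^ 2 = P2 at *
  generalize Dij x y 0 3 ^ 2 = P3 at *
  generalize Dij x y 0 4 ^ 2 = P4 at *
  generalize Dij x y 0 5 ^ 2 = P5 at *
  have hB2 : ((t 2 - t 3) * (t 4 - t 5)) ^ 2 + ((t 2 - t 4) * (t 3 - t 5)) ^ 2 +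
      ((t 2 - t 5) * (t 3 - t 4)) ^ 2 = 0 := by
    have h144 : (2 ^ 4 * 3 ^ 2 : k) ≠ 0 := mul_ne_zero (pow_ne_zero _ h2) (pow_ne_zero _ h3)
    refine (mul_eq_zero.1 (?_ : (2 ^ 4 * 3 ^ 2 *
      (l ^ 2 * P2 * P3 * P4 * P5) ^ 2) * _ = 0)).resolve_left
      (mul_ne_zero h144 (pow_ne_zero 2 hP))
    linear_combination hB1
  have hJ : ((t 2 - t 3) * (t 4 - t 5) - (t 2 - t 4) * (t 5 - t 3)) *
      ((t 2 - t 4) * (t 5 - t 3) - (t 2 - t 5) * (t 3 - t 4)) *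
      ((t 2 - t 5) * (t 3 - t 4) - (t 2 - t 3) * (t 4 - t 5)) = 0 := by
    have h48 : (2 ^ 4 : k) ≠ 0 := pow_ne_zero _ h2
    have hC2 := (mul_eq_zero.1 ((mul_assoc _ _ _).symm.trans hC1 |> fun h => by
      rw [← mul_assoc] at h; exact h)).resolve_left
      (mul_ne_zero (show (24 : k) ≠ 0 by
        have : (24 : k) = 2 ^ 3 * 3 := by norm_num
        rw [this]; exact mul_ne_zero (pow_ne_zero _ h2) h3) (pow_ne_zero 3 hP))
    clear hC1 hB1
    refine (mul_eq_zero.1 (?_ : (2 : k) * _ = 0)).resolve_left h2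
    generalize t 2 = a at *
    generalize t 3 = b at *
    generalize t 4 = c at *
    generalize t 5 = d at *
    linear_combination 3 * hC2 - 2 * ((a - b) ^ 2 + (a - c) ^ 2 + (a - d) ^ 2 + (b - c) ^ 2 +
      (b - d) ^ 2 + (c - d) ^ 2) * hB2
  rcases quartic_triple h2 h3 _ _ _ _ hB2 hJ with ⟨h, h'⟩ | ⟨h, h'⟩ | ⟨h, h'⟩ | ⟨h, h'⟩
  · exact ⟨2, 3, 4, by decide, by decide, by decide, by rw [hD 2 3 d2 d3, h]; ring,
      by rw [hD 2 4 d2 d4, h']; ring⟩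
  · exact ⟨2, 3, 5, by decide, by decide, by decide, by rw [hD 2 3 d2 d3, h]; ring,
      by rw [hD 2 5 d2 d5, h']; ring⟩
  · exact ⟨2, 4, 5, by decide, by decide, by decide, by rw [hD 2 4 d2 d4, h]; ring,
      by rw [hD 2 5 d2 d5, h']; ring⟩
  · exact ⟨3, 4, 5, by decide, by decide, by decide, by rw [hD 3 4 d3 d4, h]; ring,
      by rw [hD 3 5 d3 d5, h']; ring⟩

end TripleRootProof

/-- A binary sextic has a root of multiplicity exactly three iff its basic invariants
take the form `I₂ = 3r²`, `I₄ = 81 r⁴`, `I₆ = r⁶`, `I₁₀ = 0` for some `r ≠ 0`. -/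
theorem sextic_triple_root_iff_invariants
    (k : Type*) [Field k] [IsAlgClosed k]
    (h2 : (2 : k) ≠ 0) (h3 : (3 : k) ≠ 0) (h5 : (5 : k) ≠ 0)
    (x y : Fin 6 → k) (hroots : ∀ i, (x i, y i) ≠ (0, 0)) :
    (∃ i, rootMult x y i = 3) ↔
      ∃ r : k, r ≠ 0 ∧ I2r x y = 3 * r^2 ∧ I4r x y = 81 * r^4 ∧
        I6r x y = r^6 ∧ I10r x y = 0 := by
  have h108 : (108 : k) ≠ 0 := by
    have : (108 : k) = 2 ^ 2 * 3 ^ 3 := by norm_num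
    rw [this]; exact mul_ne_zero (pow_ne_zero _ h2) (pow_ne_zero _ h3)
  constructor
  · rintro ⟨i, hi⟩
    obtain ⟨τ, hτ⟩ := TripleRootProof.exists_perm_of_card _ 3 (by norm_num) hi
    simp only [Finset.mem_filter, Finset.mem_univ, true_and] at hτ
    have yes : ∀ a b : Fin 6, (a : ℕ) < 3 → (b : ℕ) < 3 →
        x (τ a) * y (τ b) = x (τ b) * y (τ a) := fun a b ha hb =>
      TripleRootProof.prop_trans hroots ((hτ a).1 ha) ((hτ b).1 hb)
    have no : ∀ b : Fin 6, ¬ (b : ℕ) < 3 → x (τ 0) * y (τ b) ≠ x (τ b) * y (τ 0) := by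
      intro b hb h
      apply hb
      rw [hτ b]
      have h0 := (hτ 0).1 (by decide)
      exact TripleRootProof.prop_trans hroots (i := τ 0) h0.symm h
    obtain ⟨hB, hC, r, hr, hP⟩ := TripleRootProof.triple_forward h2 h3 (x ∘ τ) (y ∘ τ)
      (fun i => hroots (τ i)) (yes 0 1 (by decide) (by decide)) (yes 0 2 (by decide) (by decide))
      (no 3 (by decide)) (no 4 (by decide)) (no 5 (by decide))
    rw [TripleRootProof.sumB_comp] at hB
    rw [TripleRootProof.sumC_comp] at hC
    rw [TripleRootProof.sumPairs_comp] at hP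
    have hI2 : I2r x y = 3 * r ^ 2 := by
      unfold I2r
      rw [hP]
      field_simp
      ring
    have hI4 : I4r x y = 81 * r ^ 4 := by
      unfold I4r
      rw [hI2, hB]
      ring
    refine ⟨r, hr, hI2, hI4, ?_, ?_⟩
    · unfold I6r
      rw [hI2, hI4, hC]
      field_simp
      ring_nf
    · rw [TripleRootProof.I10r_eq_zero_iff]
      have h01 := yes 0 1 (by decide) (by decide)
      have hne : τ 0 ≠ τ 1 := fun h => absurd (τ.injective h) (by decide)
      rcases lt_or_gt_of_ne hne with h | h
      · exact ⟨_, _, h, sub_eq_zero.2 h01⟩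
      · exact ⟨_, _, h, sub_eq_zero.2 h01.symm⟩
  · rintro ⟨r, hr, hI2, hI4, hI6, hI10⟩
    have hB : sumB x y = 0 := by
      have h80 : (2 ^ 4 * 5 : k) ≠ 0 := mul_ne_zero (pow_ne_zero _ h2) h5
      refine (mul_eq_zero.1 (?_ : (2 ^ 4 * 5 : k) * _ = 0)).resolve_left h80
      unfold I4r at hI4
      rw [hI2] at hI4
      linear_combination -hI4
    have hC : sumC x y = 0 := by
      have h25 : (5 ^ 2 * 2 ^ 2 * 3 : k) ≠ 0 :=
        mul_ne_zero (mul_ne_zero (pow_ne_zero _ h5) (pow_ne_zero _ h2)) h3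
      refine (mul_eq_zero.1 (?_ : (5 ^ 2 * 2 ^ 2 * 3 : k) * _ = 0)).resolve_left h25
      unfold I6r at hI6
      rw [hI2, hI4] at hI6
      have e1 : (108 : k) * (13 / 108) = 13 := by field_simp
      have e2 : (108 : k) * (1 / 108) = 1 := by field_simp
      have e3 : (108 : k) * (25 / 9) = 300 := by
        have h9 : (9 : k) ≠ 0 := by
          have : (9 : k) = 3 ^ 2 := by norm_num
          rw [this]; exact pow_ne_zero _ h3
        field_simp
        norm_num
      linear_combination 108 * hI6 - (3 * r ^ 2) ^ 3 * e1 + (3 * r ^ 2) * (81 * r ^ 4) * e2 -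
        sumC x y * e3
    have hP : sumPairs x y ≠ 0 := by
      intro h
      unfold I2r at hI2
      rw [h, mul_zero] at hI2
      exact mul_ne_zero h3 (pow_ne_zero 2 hr) hI2.symm
    obtain ⟨a, b, hab, hD⟩ := (TripleRootProof.I10r_eq_zero_iff x y).1 hI10
    obtain ⟨τ, hτ⟩ := TripleRootProof.exists_perm_of_card {a, b} 2 (by norm_num)
      (Finset.card_pair hab.ne)
    have h01 : x (τ 0) * y (τ 1) = x (τ 1) * y (τ 0) := by
      have t0 := (hτ 0).1 (by decide)
      have t1 := (hτ 1).1 (by decide)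
      simp only [Finset.mem_insert, Finset.mem_singleton] at t0 t1
      have hD' := sub_eq_zero.1 hD
      rcases t0 with t0 | t0 <;> rcases t1 with t1 | t1 <;> rw [t0, t1]
      · exact hD'
      · exact hD'.symm
    obtain ⟨i, c, d, hic, hid, hcd, hc, hd⟩ := TripleRootProof.triple_backward h2 h3
      (x ∘ τ) (y ∘ τ) (fun i => hroots (τ i)) h01
      (by rw [TripleRootProof.sumB_comp, hB]) (by rw [TripleRootProof.sumC_comp, hC])
    refine ⟨τ i, ?_⟩
    have h4 : ¬ 4 ≤ rootMult x y (τ i) := fun h =>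
      hP (TripleRootProof.sumPairs_eq_zero h2 h3 x y hroots (τ i) h)
    have h3' : 3 ≤ rootMult x y (τ i) := by
      have hcard : ({τ i, τ c, τ d} : Finset (Fin 6)).card = 3 :=
        Finset.card_eq_three.2 ⟨_, _, _, fun h => hic (τ.injective h),
          fun h => hid (τ.injective h), fun h => hcd (τ.injective h), rfl⟩
      rw [← hcard]
      refine Finset.card_le_card ?_
      intro j hj
      simp only [Finset.mem_insert, Finset.mem_singleton] at hj
      simp only [Finset.mem_filter, Finset.mem_univ, true_and]
      rcases hj with rfl | rfl | rfl
      · rfl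
      · exact sub_eq_zero.1 hc
      · exact sub_eq_zero.1 hd
    omega
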